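/- Let i* ∈ {1, …, n−1} be an index maximizing min{σ1(i)/s, σ2(i)}, and let W = max{σ1(i*), σ2(i*)} and w = min{σ1(i*), σ2(i*)} (SSNC assigns the set of total size W to the faster machine M1 and the set of total size w to M2, so its cover equals min{W/s, w}). Then min{W/s, w} ≥ OPT / min{1 + s/(s+1), 1 + 1/s}. -/

import Mathlib

/-- `sigma1 n p i` = total size of the `i` largest jobs (jobs `1,…,i`,
1-indexed; jobs are 0-indexed in `p`). -/
noncomputable def sigma1 (n : ℕ) (p : Fin n → ℝ) (i : ℕ) : ℝ :=
  ∑ j ∈ Finset.univ.filter (fun j : Fin n => (j : ℕ) < i), p j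

/-- `sigma2 n p i` = total size of the remaining jobs `i+1,…,n` (1-indexed). -/
noncomputable def sigma2 (n : ℕ) (p : Fin n → ℝ) (i : ℕ) : ℝ :=
  ∑ j ∈ Finset.univ.filter (fun j : Fin n => i ≤ (j : ℕ)), p j

/-- The cover of an assignment of the jobs to two machines, `M1` (machine `0`)
of speed `s` and `M2` (machine `1`) of speed `1`. -/
noncomputable def twoCover (n : ℕ) (p : Fin n → ℝ) (s : ℝ)
    (A : Fin n → Fin 2) : ℝ :=
  min ((∑ j ∈ Finset.univ.filter (fun j => A j = 0), p j) / s)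
      (∑ j ∈ Finset.univ.filter (fun j => A j = 1), p j)

theorem sigma_add (n : ℕ) (p : Fin n → ℝ) (hsum : ∑ j, p j = 1) (i : ℕ) :
    sigma1 n p i + sigma2 n p i = 1 := by
  rw [← hsum, ← Finset.sum_filter_add_sum_filter_not Finset.univ (fun j : Fin n => (j : ℕ) < i)]
  simp only [sigma1, sigma2, not_lt]

theorem sigma1_succ (n : ℕ) (p : Fin n → ℝ) (m : Fin n) :
    sigma1 n p (m + 1) = sigma1 n p m + p m := by
  unfold sigma1
  have : Finset.univ.filter (fun j : Fin n => (j : ℕ) < m + 1)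
      = insert m (Finset.univ.filter (fun j : Fin n => (j : ℕ) < m)) := by
    ext j
    simp only [Finset.mem_filter, Finset.mem_univ, true_and, Finset.mem_insert, Fin.ext_iff]
    omega
  rw [this, Finset.sum_insert (by simp), add_comm]

/-- if `i*` maximizes `min{σ1(i)/s, σ2(i)}` over
`i ∈ {1,…,n−1}`, and SSNC assigns the part of size
`W = max{σ1(i*),σ2(i*)}` to the faster machine and the part of size
`w = min{σ1(i*),σ2(i*)}` to the slower one, then its cover `min{W/s, w}` is
at least `OPT / min{1 + s/(s+1), 1 + 1/s}`. -/
theorem stmt13 (n : ℕ) (hn : 2 ≤ n) (p : Fin n → ℝ)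
    (hp : ∀ j, 0 < p j) (hsort : ∀ i j : Fin n, i ≤ j → p j ≤ p i)
    (hsum : ∑ j, p j = 1)
    (s : ℝ) (hs : 1 ≤ s)
    (OPT : ℝ)
    (hOPT : IsGreatest (Set.range fun A : Fin n → Fin 2 => twoCover n p s A) OPT)
    (istar : ℕ) (h1 : 1 ≤ istar) (h2 : istar ≤ n - 1)
    (hmax : ∀ i, 1 ≤ i → i ≤ n - 1 →
      min (sigma1 n p i / s) (sigma2 n p i)
        ≤ min (sigma1 n p istar / s) (sigma2 n p istar)) :
    OPT / min (1 + s / (s + 1)) (1 + 1 / s)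
      ≤ min (max (sigma1 n p istar) (sigma2 n p istar) / s)
            (min (sigma1 n p istar) (sigma2 n p istar)) := by
  obtain ⟨⟨A, hA⟩, -⟩ := hOPT
  have hs0 : 0 < s := by linarith
  have hadd := sigma_add n p hsum
  have n1 : ∀ i, 0 ≤ sigma1 n p i := fun i => Finset.sum_nonneg fun j _ => (hp j).le
  have n2 : ∀ i, 0 ≤ sigma2 n p i := fun i => Finset.sum_nonneg fun j _ => (hp j).le
  set V := min (sigma1 n p istar / s) (sigma2 n p istar) with hV
  have hV0 : 0 ≤ V := le_min (div_nonneg (n1 _) hs0.le) (n2 _)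
  -- the cover of SSNC is at least V
  have hCV : V ≤ min (max (sigma1 n p istar) (sigma2 n p istar) / s)
            (min (sigma1 n p istar) (sigma2 n p istar)) := by
    refine le_min ?_ (le_min ?_ (min_le_right _ _))
    · exact (min_le_left _ _).trans (div_le_div_of_nonneg_right (le_max_left _ _) hs0.le)
    · exact (min_le_left _ _).trans (div_le_self (n1 _) hs)
  refine le_trans ?_ hCV
  -- loads of the optimal assignment
  set L0 := ∑ j ∈ Finset.univ.filter (fun j => A j = 0), p j with hL0
  set L1 := ∑ j ∈ Finset.univ.filter (fun j => A j = 1), p j with hL1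
  have hL : L0 + L1 = 1 := by
    rw [← hsum, ← Finset.sum_filter_add_sum_filter_not Finset.univ (fun j => A j = 0), hL0, hL1]
    congr 2
    ext j
    simp only [Finset.mem_filter, Finset.mem_univ, true_and]
    omega
  have hO0 : s * OPT ≤ L0 := by
    have : OPT ≤ L0 / s := by rw [← hA]; exact min_le_left _ _
    rw [le_div_iff₀ hs0] at this
    linarith
  have hO1 : OPT ≤ L1 := by rw [← hA]; exact min_le_right _ _
  -- the critical index
  have hex : ∃ k, s / (s + 1) ≤ sigma1 n p k := by
    refine ⟨n, ?_⟩
    have : sigma1 n p n = 1 := by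
      rw [← hsum]; unfold sigma1
      congr 1
      ext j; simp
    rw [this, div_le_one (by linarith)]; linarith
  have hz : sigma1 n p 0 = 0 := by simp [sigma1]
  obtain ⟨m, hm⟩ : ∃ m, Nat.find hex = m + 1 := by
    refine Nat.exists_eq_succ_of_ne_zero fun h => ?_
    have := Nat.find_spec hex
    rw [h, hz] at this
    have : 0 < s / (s + 1) := by positivity
    linarith
  have hk := Nat.find_spec hex
  rw [hm] at hk
  have ha : sigma1 n p m < s / (s + 1) := by
    have := Nat.find_min hex (m := m) (by omega)
    exact not_le.mp this
  have hmn : m < n := by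
    by_contra hc
    have : sigma1 n p (m + 1) = sigma1 n p m := by
      unfold sigma1
      congr 1
      ext j
      have := j.2
      simp only [Finset.mem_filter, Finset.mem_univ, true_and]
      omega
    linarith
  have hsucc := sigma1_succ n p ⟨m, hmn⟩
  simp only at hsucc
  have hq := hp ⟨m, hmn⟩
  have hab := hadd (m + 1)
  have ham := hadd m
  rw [div_le_iff₀ (by linarith)] at hk
  rw [lt_div_iff₀ (by linarith)] at ha
  have hb : sigma2 n p (m + 1) ≤ V := by
    by_cases h : m + 1 ≤ n - 1
    · refine le_trans (le_min ?_ le_rfl) (hmax (m + 1) (by omega) h)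
      rw [le_div_iff₀ hs0]; nlinarith
    · have : sigma2 n p (m + 1) = 0 := by
        unfold sigma2
        apply Finset.sum_eq_zero
        intro j hj
        have := j.2
        simp only [Finset.mem_filter, Finset.mem_univ, true_and] at hj
        omega
      linarith
  have haV : sigma1 n p m ≤ s * V := by
    rcases Nat.eq_zero_or_pos m with h | h
    · rw [h, hz]; positivity
    · have h3 : sigma1 n p m / s ≤ V := by
        refine le_trans (le_min le_rfl ?_) (hmax m h (by omega))
        rw [div_le_iff₀ hs0]; nlinarith
      rw [div_le_iff₀ hs0] at h3
      linarith
  have hqa : 0 < m → p ⟨m, hmn⟩ ≤ sigma1 n p m := by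
    intro h
    refine (hsort ⟨0, by omega⟩ _ (Fin.mk_le_mk.mpr (by omega))).trans ?_
    exact Finset.single_le_sum (f := p) (fun j _ => (hp j).le)
      (Finset.mem_filter.mpr ⟨Finset.mem_univ _, h⟩)
  have hr1 : (0:ℝ) < min (1 + s / (s + 1)) (1 + 1 / s) := lt_min (by positivity) (by positivity)
  rw [div_le_iff₀ hr1, mul_min_of_nonneg _ _ hV0]
  have e1 : V * (1 + s / (s + 1)) = V * (2 * s + 1) / (s + 1) := by field_simp; ring
  have e2 : V * (1 + 1 / s) = V * (s + 1) / s := by field_simp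
  rw [e1, e2]
  by_cases hc : ∀ j : Fin n, (j : ℕ) ≤ m → A j = 0
  · have : L1 ≤ sigma2 n p (m + 1) := by
      refine Finset.sum_le_sum_of_subset_of_nonneg ?_ fun j _ _ => (hp j).le
      intro j hj
      simp only [Finset.mem_filter, Finset.mem_univ, true_and] at hj ⊢
      by_contra h
      have := hc j (by omega)
      rw [this] at hj
      exact absurd hj (by decide)
    have hOV : OPT ≤ V := by linarith
    refine le_min ?_ ?_
    · rw [le_div_iff₀ (by linarith)]; nlinarith
    · rw [le_div_iff₀ hs0]; nlinarith
  · push Not at hc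
    obtain ⟨j, hj, hAj⟩ := hc
    have h4 : p ⟨m, hmn⟩ ≤ L1 := by
      refine (hsort j _ (Fin.mk_le_mk.mpr hj)).trans ?_
      refine Finset.single_le_sum (f := p) (fun j _ => (hp j).le)
        (Finset.mem_filter.mpr ⟨Finset.mem_univ _, ?_⟩)
      omega
    refine le_min ?_ ?_
    · rw [le_div_iff₀ (by linarith)]
      rcases Nat.eq_zero_or_pos m with h | h
      · have h5 : sigma1 n p m = 0 := by rw [h, hz]
        have h6 : s * OPT ≤ V := by linarith
        have h7 : OPT ≤ V := by
          by_contra h8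
          nlinarith
        nlinarith
      · have := hqa h
        linarith
    · rw [le_div_iff₀ hs0]
      linarith
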